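/- With θ = 2π/5 and c = (32(5+3√5)/125)·sin θ, the following identity of polynomials in ℝ[x,y] holds: l₁·l₂·l₃·l₄·l₅ = c⁻¹·P₂, i.e. the product of the five 'blue' affine linear forms equals c⁻¹ times the quintic P₂. -/

import Mathlib

open MvPolynomial

/-- The quintic `P₂` (defining the five blue lines of the double star arrangement),
as an element of `ℝ[x,y]`. -/
noncomputable def P₂ : MvPolynomial (Fin 2) ℝ :=
  C (2/5) * X 0 ^ 5 - C 4 * X 0 ^ 3 * X 1 ^ 2 + C 2 * X 0 * X 1 ^ 4
    + C ((1 - Real.sqrt 5)/2) * X 0 ^ 4 + C (1 - Real.sqrt 5) * X 0 ^ 2 * X 1 ^ 2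
    + C ((1 - Real.sqrt 5)/2) * X 1 ^ 4
    - C (2 - Real.sqrt 5) * X 0 ^ 2 - C (2 - Real.sqrt 5) * X 1 ^ 2
    + C ((11 - 5 * Real.sqrt 5)/10)

/-- The constant `c = (32(5+3√5)/125)·sin(2π/5)`. -/
noncomputable def cDS : ℝ := 32 * (5 + 3 * Real.sqrt 5) / 125 * Real.sin (2 * Real.pi / 5)

/-- θ = 2π/5. -/
noncomputable def θDS : ℝ := 2 * Real.pi / 5

/-- The five "blue" affine linear forms `l₁, …, l₅` in `ℝ[x,y]`. -/
noncomputable def l₁ : MvPolynomial (Fin 2) ℝ :=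
  C (Real.sin (2 * θDS) - Real.sin θDS) * X 0 + C (Real.cos (2 * θDS) - Real.cos θDS) * X 1
    - C (Real.sin θDS * Real.cos θDS / Real.cos (2 * θDS))

noncomputable def l₂ : MvPolynomial (Fin 2) ℝ :=
  C (-Real.sin θDS) * X 0 + C (Real.cos θDS - 1) * X 1
    + C (Real.sin θDS * Real.cos θDS / Real.cos (2 * θDS))

noncomputable def l₃ : MvPolynomial (Fin 2) ℝ :=
  C (2 * Real.sin (2 * θDS)) * X 0 + C (Real.sin θDS * Real.cos θDS / Real.cos (2 * θDS))

noncomputable def l₄ : MvPolynomial (Fin 2) ℝ :=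
  C (Real.sin θDS) * X 0 + C (Real.cos θDS - 1) * X 1
    - C (Real.sin θDS * Real.cos θDS / Real.cos (2 * θDS))

noncomputable def l₅ : MvPolynomial (Fin 2) ℝ :=
  C (-(Real.sin (2 * θDS) - Real.sin θDS)) * X 0 + C (Real.cos (2 * θDS) - Real.cos θDS) * X 1
    + C (Real.sin θDS * Real.cos θDS / Real.cos (2 * θDS))

open Real in
theorem cos_θDS : cos θDS = (√5 - 1) / 4 := by
  have h5 : √5 ^ 2 = 5 := sq_sqrt (by norm_num)
  rw [θDS, mul_div_assoc, cos_two_mul, cos_pi_div_five]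
  linear_combination h5 / 8

open Real in
theorem cos_two_mul_θDS : cos (2 * θDS) = -(1 + √5) / 4 := by
  have h5 : √5 ^ 2 = 5 := sq_sqrt (by norm_num)
  rw [cos_two_mul, cos_θDS]
  linear_combination h5 / 8

open Real in
theorem sin_two_mul_θDS : sin (2 * θDS) = sin θDS * (√5 - 1) / 2 := by
  rw [sin_two_mul, cos_θDS]
  ring

open Real in
theorem sin_θDS_sq : sin θDS ^ 2 = (5 + √5) / 8 := by
  have h5 : √5 ^ 2 = 5 := sq_sqrt (by norm_num)
  rw [sin_sq, cos_θDS]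
  linear_combination -h5 / 16

open Real in
theorem sin_mul_cos_div_cos_two_mul_θDS :
    sin θDS * cos θDS / cos (2 * θDS) = sin θDS * (√5 - 3) / 2 := by
  have h5 : √5 ^ 2 = 5 := sq_sqrt (by norm_num)
  have h : -(1 + √5) / 4 ≠ 0 := by
    have := sqrt_nonneg 5
    linarith
  rw [cos_two_mul_θDS, cos_θDS, div_eq_iff h]
  linear_combination sin θDS * h5 / 8

open Real in
theorem cDS_inv : cDS⁻¹ = sin θDS * (25 * (√5 - 2) / 16) := by
  have h5 : √5 ^ 2 = 5 := sq_sqrt (by norm_num)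
  refine inv_eq_of_mul_eq_one_right ?_
  change 32 * (5 + 3 * √5) / 125 * sin θDS * _ = 1
  linear_combination (2 / 5 * (5 + 3 * √5) * (√5 - 2)) * sin_θDS_sq +
    (3 * √5 + 14) / 20 * h5

/-- The product of the five blue affine linear forms equals `c⁻¹ · P₂` in `ℝ[x,y]`. -/
theorem blue_product_eq : l₁ * l₂ * l₃ * l₄ * l₅ = C cDS⁻¹ * P₂ := by
  refine MvPolynomial.funext fun v => ?_
  simp only [l₁, l₂, l₃, l₄, l₅, P₂, map_mul, map_add, map_sub, map_pow, eval_C, eval_X,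
    sin_mul_cos_div_cos_two_mul_θDS, cDS_inv]
  simp only [sin_two_mul_θDS, cos_two_mul_θDS, cos_θDS]
  have h5 : √5 ^ 2 = 5 := Real.sq_sqrt (by norm_num)
  have hs := sin_θDS_sq
  generalize √5 = r at *
  generalize Real.sin θDS = s at *
  generalize v 0 = x
  generalize v 1 = y
  have h15 : (s * (r - 3) / 2 * (x - 1) - r / 2 * y) * (-(s * (r - 3) / 2 * (x - 1)) - r / 2 * y) =
      5 / 4 * y ^ 2 - (5 - 2 * r) / 4 * (x - 1) ^ 2 := by
    linear_combination (-(r - 3) ^ 2 / 4 * (x - 1) ^ 2) * hs +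
      (y ^ 2 / 4 - (r - 1) / 32 * (x - 1) ^ 2) * h5
  have h24 : (-s * x + (r - 5) / 4 * y + s * (r - 3) / 2) *
      (s * x + (r - 5) / 4 * y - s * (r - 3) / 2) =
      (15 - 5 * r) / 8 * y ^ 2 - (5 + r) / 8 * (x - (r - 3) / 2) ^ 2 := by
    linear_combination (-(x - (r - 3) / 2) ^ 2) * hs + y ^ 2 / 16 * h5
  calc
    _ = ((s * (r - 3) / 2 * (x - 1) - r / 2 * y) * (-(s * (r - 3) / 2 * (x - 1)) - r / 2 * y)) *
        ((-s * x + (r - 5) / 4 * y + s * (r - 3) / 2) *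
          (s * x + (r - 5) / 4 * y - s * (r - 3) / 2)) *
        (s * ((r - 1) * x + (r - 3) / 2)) := by ring
    _ = _ := by
      rw [h15, h24]
      linear_combination s * (((-16 * r - 24) * x ^ 5 +
          (16 * r ^ 2 + 20) * x ^ 4 +
          (-80 * r + 480) * x ^ 3 * y ^ 2 +
          (-4 * r ^ 3 - 6 * r ^ 2 + 60 * r - 50) * x ^ 3 +
          (160 * r - 280) * x ^ 2 * y ^ 2 +
          (6 * r ^ 3 - 23 * r ^ 2 - 50 * r + 95) * x ^ 2 +
          (-200) * x * y ^ 4 +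
          (-10 * r ^ 2 + 40 * r - 30) * x * y ^ 2 +
          100 * y ^ 4 +
          (-5 * r ^ 2 - 20 * r + 5) * y ^ 2 +
          (-2 * r ^ 3 + 13 * r ^ 2 + 6 * r - 41)) / 256) * h5
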